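/- Let s : I → R be an injective R-module homomorphism whose class generates Ext¹_R(R/I, R) as an R/I-module, set J = s(I), and assume I is not principal (so J ≠ R). Then Ext¹_R(R/J, R) is a free R/J-module of rank one, generated by the class of t = s⁻¹ : J → I ⊆ R under the identification Ext¹_R(R/J, R) ≅ Hom_R(J, R)/(R·ι_J). Consequently R/J is a Gorenstein local ring of Krull dimension n − 1. -/

import Mathlib

open CategoryTheory

/-- `Ext^i_R(M, N)`, as an `R`-module, computed via projective resolutions. -/
noncomputable def extMod (R : Type) [CommRing R] (i : ℕ) (M N : ModuleCat.{0} R) :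
    ModuleCat R :=
  ((_root_.Ext R (ModuleCat.{0} R) i).obj (Opposite.op M)).obj N

/-- The depth of a local ring `A`, `inf { i | Ext^i(k, A) ≠ 0 }`. -/
noncomputable def ringDepth (A : Type) [CommRing A] [IsLocalRing A] : ℕ :=
  sInf {i : ℕ |
    ¬ Subsingleton (extMod A i (ModuleCat.of A (IsLocalRing.ResidueField A))
      (ModuleCat.of A A))}

/-- A Noetherian local ring `A` is Gorenstein of dimension `m` if it is Cohen--Macaulay
(depth = Krull dimension = `m`) and `Ext^m(k, A) ≅ k`. -/
def IsGorensteinLocalOfDim (A : Type) [CommRing A] [IsLocalRing A] (m : ℕ) : Prop :=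
  IsNoetherianRing A ∧ ringKrullDim A = m ∧ ringDepth A = m ∧
    Nonempty (extMod A m (ModuleCat.of A (IsLocalRing.ResidueField A)) (ModuleCat.of A A)
      ≃ₗ[A] IsLocalRing.ResidueField A)

/-- The inverse `t = s⁻¹ : J → I ⊆ R` of an injective homomorphism `s : I → R` with image
`J = s(I)`, viewed as an element of `Hom_R(J, R)`. -/
noncomputable def inverseHom (R : Type) [CommRing R] (I : Ideal R) (s : I →ₗ[R] R)
    (hs : Function.Injective s) : (LinearMap.range s : Ideal R) →ₗ[R] R :=
  (Submodule.subtype I).comp (LinearEquiv.ofInjective s hs).symm.toLinearMap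

section Auxiliary

open RingTheory.Sequence

section ExtComparison

variable {R : Type} [CommRing R] {M : ModuleCat.{0} R}

theorem extMk_zero_eq_zero_iff (P : ProjectiveResolution M) {N : ModuleCat.{0} R}
    (f : P.complex.X 0 ⟶ N) (m : ℕ) (hm : 0 + 1 = m) (hf : P.complex.d m 0 ≫ f = 0) :
    P.extMk f m hm hf = 0 ↔ f = 0 := by
  subst hm
  constructor
  · intro h
    rw [← P.extEquivCohomologyClass.apply_eq_iff_eq, P.extEquivCohomologyClass_extMk,
      P.extEquivCohomologyClass_zero, CochainComplex.HomComplex.CohomologyClass.mk_eq_zero_iff,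
      CochainComplex.HomComplex.Cocycle.toSingleMk_mem_coboundaries_iff _ _ _ _ _ 1 (by simp)] at h
    obtain ⟨g, hg⟩ := h
    have : P.cochainComplex.d (-(0 : ℕ)) 1 = 0 := by
      apply Limits.IsZero.eq_of_tgt
      exact CochainComplex.isZero_of_isStrictlyLE _ 0 _ (by simp)
    rw [this, Limits.zero_comp] at hg
    rw [← cancel_epi (P.cochainComplexXIso (-(0 : ℕ)) 0 rfl).hom, ← hg, Limits.comp_zero]
  · rintro rfl
    simp

noncomputable def cocyclesToExt (P : ProjectiveResolution M) (N : ModuleCat.{0} R) (n m : ℕ)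
    (hm : n + 1 = m) :
    LinearMap.ker (((P.complex.linearYonedaObj R N).d n m).hom) →ₗ[R] Abelian.Ext M N n where
  toFun f := P.extMk (X := M) (f.1 : P.complex.X n ⟶ N) m hm f.2
  map_add' f g := (P.add_extMk _ _ m hm _ _).symm
  map_smul' r f := by
    simp only [RingHom.id_apply]
    rw [Abelian.Ext.smul_eq_comp_mk₀]
    refine Eq.trans ?_ (P.extMk_comp_mk₀ (f.1 : P.complex.X n ⟶ N) m hm f.2 (r • 𝟙 N)).symm
    congr 1
theorem cocyclesToExt_surjective (P : ProjectiveResolution M) (N : ModuleCat.{0} R) (n m : ℕ)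
    (hm : n + 1 = m) : Function.Surjective (cocyclesToExt P N n m hm) := fun α ↦ by
  obtain ⟨f, hf, rfl⟩ := P.extMk_surjective α m hm
  exact ⟨⟨f, hf⟩, rfl⟩

theorem nonempty_extMod_linearEquiv (M N : ModuleCat.{0} R) (n : ℕ) :
    Nonempty (extMod R n M N ≃ₗ[R] Abelian.Ext M N n) := by
  let P := projectiveResolution M
  let S := (P.complex.linearYonedaObj R N).sc n
  have hnext : (ComplexShape.up ℕ).next n = n + 1 := by simp
  let φ : LinearMap.ker S.g.hom →ₗ[R] Abelian.Ext M N n :=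
    cocyclesToExt P N n ((ComplexShape.up ℕ).next n) hnext.symm
  have hφs : Function.Surjective φ := cocyclesToExt_surjective P N n _ _
  have hφ : LinearMap.ker φ = LinearMap.range S.moduleCatToCycles := by
    ext x
    have hx : P.complex.d ((ComplexShape.up ℕ).next n) n ≫ (x.1 : P.complex.X n ⟶ N) = 0 := x.2
    have h1 : x ∈ LinearMap.ker φ ↔ P.extMk (x.1 : P.complex.X n ⟶ N) _ hnext.symm hx = 0 :=
      Iff.rfl
    have h2 : x ∈ LinearMap.range S.moduleCatToCycles ↔
        ∃ g : P.complex.X ((ComplexShape.up ℕ).prev n) ⟶ N,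
          P.complex.d n ((ComplexShape.up ℕ).prev n) ≫ g = (x.1 : P.complex.X n ⟶ N) := by
      rw [LinearMap.mem_range]
      exact exists_congr fun g ↦ Subtype.ext_iff
    rw [h1, h2]
    cases n with
    | zero =>
      refine (extMk_zero_eq_zero_iff P (x.1 : P.complex.X 0 ⟶ N) _ _ hx).trans ?_
      have h3 : P.complex.d 0 ((ComplexShape.up ℕ).prev 0) = 0 := by simp
      rw [h3]
      exact ⟨fun h ↦ ⟨0, Limits.zero_comp.trans h.symm⟩,
        fun ⟨g, hg⟩ ↦ hg.symm.trans Limits.zero_comp⟩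
    | succ k => exact P.extMk_eq_zero_iff _ _ _ _ _ (by simp)
  exact ⟨((P.isoExt n N).toLinearEquiv.trans S.moduleCatHomologyIso.toLinearEquiv).trans
    ((Submodule.quotEquivOfEq _ _ hφ.symm).trans (φ.quotKerEquivOfSurjective hφs))⟩

end ExtComparison

section Shift

variable {R : Type} [CommRing R]

theorem ext_smul_eq_zero_of_mem_annihilator {N M : ModuleCat.{0} R} {x : R}
    (hx : x ∈ Module.annihilator R N) {i : ℕ} (α : Abelian.Ext N M i) : x • α = 0 := by
  have h : (x • 𝟙 N) = 0 := by
    simp [← ModuleCat.lsmul_eq_smul_id, Module.mem_annihilator_iff_lsmul_eq_zero.mp hx]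
  have h2 : x • α = (Abelian.Ext.mk₀ (x • 𝟙 N)).comp α (zero_add i) := by
    simp [Abelian.Ext.mk₀_smul]
  rw [h2, h, Abelian.Ext.mk₀_zero, Abelian.Ext.zero_comp]

theorem subsingleton_ext_and_nonempty_linearEquiv (N : Type) [AddCommGroup N] [Module R N]
    (rs : List R) (hN : ∀ r ∈ rs, r ∈ Module.annihilator R N)
    (M : Type) [AddCommGroup M] [Module R M] (hM : IsWeaklyRegular M rs) :
    (∀ i < rs.length, Subsingleton (Abelian.Ext (ModuleCat.of R N) (ModuleCat.of R M) i)) ∧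
    Nonempty (Abelian.Ext (ModuleCat.of R N) (ModuleCat.of R M) rs.length ≃ₗ[R]
      (N →ₗ[R] M ⧸ (Ideal.ofList rs • (⊤ : Submodule R M)))) := by
  induction rs generalizing M with
  | nil =>
    refine ⟨by simp, ⟨(Abelian.Ext.linearEquiv₀ (R := R)).trans
      (ModuleCat.homLinearEquiv.trans (LinearEquiv.congrRight ?_))⟩⟩
    exact (Submodule.quotEquivOfEqBot _ (by simp)).symm
  | cons x rs ih =>
    rw [isWeaklyRegular_cons_iff] at hM
    obtain ⟨hx, hM'⟩ := hM
    obtain ⟨ih1, ⟨e⟩⟩ := ih (fun r hr ↦ hN r (by simp [hr])) (QuotSMulTop x M) hM'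
    have hxN := hN x (by simp)
    have hS : ((ModuleCat.of R M).smulShortComplex x).ShortExact :=
      IsSMulRegular.smulShortComplex_shortExact (M := ModuleCat.of R M) hx
    have key (j : ℕ) : Function.Surjective (Abelian.Ext.postcompOfLinear hS.extClass R
        (ModuleCat.of R N) (rfl : j + 1 = j + 1)) := by
      intro α
      obtain ⟨β, hβ⟩ := Abelian.Ext.covariant_sequence_exact₁ (ModuleCat.of R N) hS α
        (by
          rw [ModuleCat.smulShortComplex_f_eq_smul_id]
          exact (Abelian.Ext.smul_eq_comp_mk₀ α x).symm.trans
            (ext_smul_eq_zero_of_mem_annihilator hxN α)) rfl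
      exact ⟨β, hβ⟩
    have h1 : ∀ i < (x :: rs).length,
        Subsingleton (Abelian.Ext (ModuleCat.of R N) (ModuleCat.of R M) i) := by
      intro i hi
      cases i with
      | zero =>
        have : Subsingleton (N →ₗ[R] M) :=
          hx.linearMap_subsingleton_of_mem_annihilator hxN
        exact ((Abelian.Ext.linearEquiv₀ (R := R)).trans
          ModuleCat.homLinearEquiv).toEquiv.subsingleton
      | succ j =>
        have : Subsingleton (Abelian.Ext (ModuleCat.of R N)
          ((ModuleCat.of R M).smulShortComplex x).X₃ j) := ih1 j (by simpa using hi)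
        exact (key j).subsingleton
    refine ⟨h1, ?_⟩
    have hinj : Function.Injective (Abelian.Ext.postcompOfLinear hS.extClass R
        (ModuleCat.of R N) (rfl : rs.length + 1 = rs.length + 1)) := by
      rw [injective_iff_map_eq_zero]
      intro β hβ
      obtain ⟨γ, hγ⟩ := Abelian.Ext.covariant_sequence_exact₃ (ModuleCat.of R N) hS β rfl hβ
      have : Subsingleton (Abelian.Ext (ModuleCat.of R N)
        ((ModuleCat.of R M).smulShortComplex x).X₂ rs.length) := h1 rs.length (by simp)
      rw [← hγ, Subsingleton.elim γ 0, Abelian.Ext.zero_comp]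
    exact ⟨((LinearEquiv.ofBijective _ ⟨hinj, key _⟩).symm.trans e).trans
      (LinearEquiv.congrRight
        (Submodule.quotOfListConsSMulTopEquivQuotSMulTopInner M x rs).symm)⟩

end Shift

section ExtVanishing

variable {R : Type} [CommRing R] {A B C : Type} [AddCommGroup A] [Module R A] [AddCommGroup B]
  [Module R B] [AddCommGroup C] [Module R C] {f : A →ₗ[R] B} {g : B →ₗ[R] C}

theorem subsingleton_ext_right (hf : Function.Injective f) (hg : Function.Surjective g)
    (h : Function.Exact f g) (N : ModuleCat.{0} R) (i : ℕ)
    (hB : Subsingleton (Abelian.Ext N (ModuleCat.of R B) i))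
    (hA : Subsingleton (Abelian.Ext N (ModuleCat.of R A) (i + 1))) :
    Subsingleton (Abelian.Ext N (ModuleCat.of R C) i) := by
  let S := ModuleCat.shortComplexOfCompEqZero f g h.linearMap_comp_eq_zero
  have hS : S.ShortExact := ModuleCat.shortComplex_shortExact S h hf hg
  have hB' : Subsingleton (Abelian.Ext N S.X₂ i) := hB
  have hA' : Subsingleton (Abelian.Ext N S.X₁ (i + 1)) := hA
  refine subsingleton_of_forall_eq (0 : Abelian.Ext N S.X₃ i) fun α ↦ ?_
  obtain ⟨β, rfl⟩ := Abelian.Ext.covariant_sequence_exact₃ N hS α rfl (Subsingleton.elim _ _)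
  rw [Subsingleton.elim β 0, Abelian.Ext.zero_comp]

theorem subsingleton_ext_left (hf : Function.Injective f) (hg : Function.Surjective g)
    (h : Function.Exact f g) (N : ModuleCat.{0} R) (i : ℕ)
    (hB : Subsingleton (Abelian.Ext N (ModuleCat.of R B) (i + 1)))
    (hC : Subsingleton (Abelian.Ext N (ModuleCat.of R C) i)) :
    Subsingleton (Abelian.Ext N (ModuleCat.of R A) (i + 1)) := by
  let S := ModuleCat.shortComplexOfCompEqZero f g h.linearMap_comp_eq_zero
  have hS : S.ShortExact := ModuleCat.shortComplex_shortExact S h hf hg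
  have hB' : Subsingleton (Abelian.Ext N S.X₂ (i + 1)) := hB
  have hC' : Subsingleton (Abelian.Ext N S.X₃ i) := hC
  refine subsingleton_of_forall_eq (0 : Abelian.Ext N S.X₁ (i + 1)) fun α ↦ ?_
  obtain ⟨β, rfl⟩ := Abelian.Ext.covariant_sequence_exact₁ N hS α (Subsingleton.elim _ _) rfl
  rw [Subsingleton.elim β 0, Abelian.Ext.zero_comp]

theorem subsingleton_ext_middle (hf : Function.Injective f) (hg : Function.Surjective g)
    (h : Function.Exact f g) (N : ModuleCat.{0} R) (i : ℕ)
    (hA : Subsingleton (Abelian.Ext N (ModuleCat.of R A) i))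
    (hC : Subsingleton (Abelian.Ext N (ModuleCat.of R C) i)) :
    Subsingleton (Abelian.Ext N (ModuleCat.of R B) i) := by
  let S := ModuleCat.shortComplexOfCompEqZero f g h.linearMap_comp_eq_zero
  have hS : S.ShortExact := ModuleCat.shortComplex_shortExact S h hf hg
  have hA' : Subsingleton (Abelian.Ext N S.X₁ i) := hA
  have hC' : Subsingleton (Abelian.Ext N S.X₃ i) := hC
  refine subsingleton_of_forall_eq (0 : Abelian.Ext N S.X₂ i) fun α ↦ ?_
  obtain ⟨β, rfl⟩ := Abelian.Ext.covariant_sequence_exact₂ N hS α (Subsingleton.elim _ _)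
  rw [Subsingleton.elim β 0, Abelian.Ext.zero_comp]

end ExtVanishing

section Socle

open IsLocalRing

/-- The socle of a module over a local ring is nonzero and generated by one element. -/
def HasSimpleSocle (R X : Type) [CommRing R] [IsLocalRing R] [AddCommGroup X] [Module R X] :
    Prop :=
  ∃ u : X, u ≠ 0 ∧ (∀ r ∈ maximalIdeal R, r • u = 0) ∧
    ∀ v : X, (∀ r ∈ maximalIdeal R, r • v = 0) → ∃ a : R, v = a • u

variable {R X : Type} [CommRing R] [IsLocalRing R] [AddCommGroup X] [Module R X]

theorem smul_residueField_eq_zero {r : R} (hr : r ∈ maximalIdeal R) (z : ResidueField R) :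
    r • z = 0 := by
  rw [Algebra.smul_def]
  have : algebraMap R (ResidueField R) r = 0 := (residue_eq_zero_iff r).mpr hr
  rw [this, zero_mul]

theorem mem_annihilator_residueField {r : R} (hr : r ∈ maximalIdeal R) :
    r ∈ Module.annihilator R (ResidueField R) :=
  Module.mem_annihilator.mpr (smul_residueField_eq_zero hr)

theorem exists_residueField_map_one {v : X} (hv : ∀ r ∈ maximalIdeal R, r • v = 0) :
    ∃ f : ResidueField R →ₗ[R] X, f 1 = v := by
  have h : (maximalIdeal R : Submodule R R) ≤ LinearMap.ker (LinearMap.toSpanSingleton R X v) :=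
    fun r hr ↦ by simpa using hv r hr
  refine ⟨Submodule.liftQ (maximalIdeal R : Submodule R R) _ h, ?_⟩
  exact (Submodule.liftQ_apply _ _ (1 : R)).trans (by simp)

theorem residueField_hom_ext {f g : ResidueField R →ₗ[R] X} (h : f 1 = g 1) : f = g := by
  ext z
  obtain ⟨r, rfl⟩ := residue_surjective z
  have : residue R r = r • (1 : ResidueField R) := by
    rw [Algebra.smul_def, mul_one]; rfl
  rw [this, map_smul, map_smul, h]

theorem hasSimpleSocle_iff :
    HasSimpleSocle R X ↔ Nonempty ((ResidueField R →ₗ[R] X) ≃ₗ[R] ResidueField R) := by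
  constructor
  · rintro ⟨u, hu0, hu, huniq⟩
    obtain ⟨f, hf⟩ := exists_residueField_map_one hu
    have hsm : ∀ r ∈ maximalIdeal R, r • f = 0 := fun r hr ↦
      residueField_hom_ext (by simpa [hf] using hu r hr)
    obtain ⟨φ, hφ⟩ := exists_residueField_map_one hsm
    refine ⟨(LinearEquiv.ofBijective φ ⟨?_, ?_⟩).symm⟩
    · rw [injective_iff_map_eq_zero]
      intro z hz
      by_contra hz0
      have : φ 1 = 0 := by
        obtain ⟨r, hr⟩ := residue_surjective z⁻¹
        have h1 : (1 : ResidueField R) = r • z := by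
          rw [Algebra.smul_def]
          change 1 = residue R r * z
          rw [hr, inv_mul_cancel₀ hz0]
        rw [h1, map_smul, hz, smul_zero]
      exact hu0 (by rw [← hf, ← hφ, this, LinearMap.zero_apply])
    · intro g
      obtain ⟨a, ha⟩ := huniq (g 1) fun r hr ↦ by
        rw [← map_smul, smul_residueField_eq_zero hr, map_zero]
      refine ⟨a • 1, residueField_hom_ext ?_⟩
      rw [map_smul, hφ, LinearMap.smul_apply, hf, ha]
  · rintro ⟨e⟩
    refine ⟨e.symm 1 1, ?_, ?_, ?_⟩
    · intro h
      have : e.symm 1 = 0 := residueField_hom_ext (by simpa using h)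
      simp at this
    · intro r hr
      rw [← map_smul, smul_residueField_eq_zero hr, map_zero]
    · intro v hv
      obtain ⟨f, rfl⟩ := exists_residueField_map_one hv
      obtain ⟨a, ha⟩ := residue_surjective (e f)
      refine ⟨a, ?_⟩
      have : f = a • e.symm 1 := by
        rw [← map_smul, LinearEquiv.eq_symm_apply, ← ha, Algebra.smul_def, mul_one]; rfl
      conv_lhs => rw [this]
      rfl

end Socle

section Gorenstein

open IsLocalRing

variable {A : Type} [CommRing A] [IsLocalRing A] {m : ℕ}

theorem IsGorensteinLocalOfDim.subsingleton_ext (h : IsGorensteinLocalOfDim A m) {i : ℕ}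
    (hi : i < m) :
    Subsingleton (Abelian.Ext (ModuleCat.of A (ResidueField A)) (ModuleCat.of A A) i) := by
  obtain ⟨-, -, hd, -⟩ := h
  rw [← hd] at hi
  have := Nat.notMem_of_lt_sInf hi
  simp only [Set.mem_ofPred_eq, not_not] at this
  obtain ⟨e⟩ := nonempty_extMod_linearEquiv (ModuleCat.of A (ResidueField A)) (ModuleCat.of A A) i
  exact e.symm.toEquiv.subsingleton

theorem IsGorensteinLocalOfDim.hasSimpleSocle (h : IsGorensteinLocalOfDim A m) {rs : List A}
    (hrs : ∀ r ∈ rs, r ∈ maximalIdeal A) (hreg : IsWeaklyRegular A rs) (hlen : rs.length = m) :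
    HasSimpleSocle A (A ⧸ (Ideal.ofList rs • (⊤ : Submodule A A))) := by
  obtain ⟨-, -, -, ⟨e⟩⟩ := h
  subst hlen
  obtain ⟨e1⟩ := nonempty_extMod_linearEquiv (ModuleCat.of A (ResidueField A))
    (ModuleCat.of A A) rs.length
  obtain ⟨-, ⟨e2⟩⟩ := subsingleton_ext_and_nonempty_linearEquiv (ResidueField A) rs
    (fun r hr ↦ mem_annihilator_residueField (hrs r hr)) A hreg
  exact hasSimpleSocle_iff.mpr ⟨e2.symm.trans (e1.symm.trans e)⟩

theorem isGorensteinLocalOfDim_of_isWeaklyRegular [IsNoetherianRing A] (hdim : ringKrullDim A = m)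
    {rs : List A} (hrs : ∀ r ∈ rs, r ∈ maximalIdeal A) (hreg : IsWeaklyRegular A rs)
    (hlen : rs.length = m)
    (hsoc : HasSimpleSocle A (A ⧸ (Ideal.ofList rs • (⊤ : Submodule A A)))) :
    IsGorensteinLocalOfDim A m := by
  subst hlen
  obtain ⟨h1, ⟨e2⟩⟩ := subsingleton_ext_and_nonempty_linearEquiv (ResidueField A) rs
    (fun r hr ↦ mem_annihilator_residueField (hrs r hr)) A hreg
  obtain ⟨e3⟩ := hasSimpleSocle_iff.mp hsoc
  obtain ⟨e1⟩ := nonempty_extMod_linearEquiv (ModuleCat.of A (ResidueField A))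
    (ModuleCat.of A A) rs.length
  have e := (e1.trans e2).trans e3
  refine ⟨‹_›, hdim, ?_, ⟨e⟩⟩
  have hmem : rs.length ∈ {i : ℕ | ¬ Subsingleton (extMod A i (ModuleCat.of A (ResidueField A))
      (ModuleCat.of A A))} := fun hsub ↦
    not_subsingleton (ResidueField A) e.symm.toEquiv.subsingleton
  refine le_antisymm (Nat.sInf_le hmem) (le_csInf ⟨_, hmem⟩ fun i hi ↦ ?_)
  by_contra! hlt
  obtain ⟨e4⟩ := nonempty_extMod_linearEquiv (ModuleCat.of A (ResidueField A))
    (ModuleCat.of A A) i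
  have := h1 i hlt
  exact hi e4.toEquiv.subsingleton

end Gorenstein

section Depth

open IsLocalRing

variable {R : Type} [CommRing R] [IsLocalRing R] [IsNoetherianRing R]

theorem exists_isWeaklyRegular_of_subsingleton_ext (M : Type) [AddCommGroup M] [Module R M]
    [Module.Finite R M] [Nontrivial M] (d K : ℕ) (hK : K ≠ 0)
    (h : ∀ i < d, Subsingleton
      (Abelian.Ext (ModuleCat.of R (ResidueField R)) (ModuleCat.of R M) i)) :
    ∃ rs : List R, rs.length = d ∧ (∀ r ∈ rs, r ∈ maximalIdeal R ^ K) ∧ IsWeaklyRegular M rs := by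
  have hlt : (maximalIdeal R ^ K) • (⊤ : Submodule R M) < ⊤ := by
    refine lt_of_le_of_lt (Submodule.smul_mono_left (Ideal.pow_le_self hK)) ?_
    refine lt_top_iff_ne_top.mpr fun htop ↦ ?_
    exact top_ne_bot (Submodule.eq_bot_of_le_smul_of_le_jacobson_bot (maximalIdeal R)
      (⊤ : Submodule R M) Module.Finite.fg_top htop.ge (maximalIdeal_le_jacobson _))
  have hsupp : Module.support R (ResidueField R) = PrimeSpectrum.zeroLocus
      ((maximalIdeal R ^ K : Ideal R) : Set R) := by
    rw [PrimeSpectrum.zeroLocus_pow _ hK]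
    have : Module.annihilator R (R ⧸ maximalIdeal R) = maximalIdeal R :=
      Ideal.annihilator_quotient
    rw [← this]
    exact Module.support_eq_zeroLocus
  obtain ⟨rs, hlen, hmem, hreg⟩ := ModuleCat.exists_isRegular_of_exists_subsingleton_ext
    (maximalIdeal R ^ K) d (ModuleCat.of R M) hlt (ModuleCat.of R (ResidueField R)) hsupp h
  exact ⟨rs, hlen, hmem, hreg.toIsWeaklyRegular⟩

end Depth

section WeaklyRegular

variable {R : Type} [CommRing R] {A B C : Type} [AddCommGroup A] [Module R A] [AddCommGroup B]
  [Module R B] [AddCommGroup C] [Module R C]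

theorem isWeaklyRegular_of_leftInverse {f : A →ₗ[R] B} {g : B →ₗ[R] A} (h : g ∘ₗ f = .id)
    {rs : List R} (hB : IsWeaklyRegular B rs) : IsWeaklyRegular A rs := by
  induction rs generalizing A B with
  | nil => exact .nil R A
  | cons x rs ih =>
    rw [isWeaklyRegular_cons_iff] at hB ⊢
    refine ⟨hB.1.of_injective f (Function.LeftInverse.injective (g := g) (DFunLike.congr_fun h)),
      ih (f := QuotSMulTop.map x f) (g := QuotSMulTop.map x g) ?_ hB.2⟩
    rw [← QuotSMulTop.map_comp, h, QuotSMulTop.map_id]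

theorem isWeaklyRegular_append_singleton_iff {rs : List R} {w : R} :
    IsWeaklyRegular A (rs ++ [w]) ↔ IsWeaklyRegular A rs ∧
      ∀ x : A, w • x ∈ Ideal.ofList rs • (⊤ : Submodule R A) →
        x ∈ Ideal.ofList rs • (⊤ : Submodule R A) := by
  rw [isWeaklyRegular_append_iff, isWeaklyRegular_singleton_iff,
    isSMulRegular_quotient_iff_mem_of_smul_mem]

variable {f : A →ₗ[R] B} {g : B →ₗ[R] C}

open scoped Pointwise in
theorem quotSMulTop_map_injective (hf : Function.Injective f) (h : Function.Exact f g) {x : R}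
    (hC : IsSMulRegular C x) : Function.Injective (QuotSMulTop.map x f) := by
  rw [injective_iff_map_eq_zero]
  intro a ha
  obtain ⟨a, rfl⟩ := Submodule.mkQ_surjective _ a
  have ha' : f a ∈ x • (⊤ : Submodule R B) := (Submodule.Quotient.mk_eq_zero _).mp ha
  obtain ⟨b, -, hb : x • b = f a⟩ := Submodule.mem_smul_pointwise_iff_exists _ _ _ |>.mp ha'
  have hgb : g b = 0 := hC.right_eq_zero_of_smul (by rw [← map_smul, hb, h.apply_apply_eq_zero])
  obtain ⟨a', rfl⟩ := (h b).mp hgb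
  have : a = x • a' := hf (by rw [map_smul, hb])
  rw [this]
  exact (Submodule.Quotient.mk_eq_zero _).mpr (Submodule.smul_mem_pointwise_smul _ _ _ trivial)

theorem isWeaklyRegular_of_exact (hf : Function.Injective f) (h : Function.Exact f g)
    (hg : Function.Surjective g) {rs : List R} (hB : IsWeaklyRegular B rs)
    (hC : IsWeaklyRegular C rs) : IsWeaklyRegular A rs := by
  induction rs generalizing A B C with
  | nil => exact .nil R A
  | cons x rs ih =>
    rw [isWeaklyRegular_cons_iff] at hB hC ⊢
    exact ⟨hB.1.of_injective f hf, ih (quotSMulTop_map_injective hf h hC.1)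
      (QuotSMulTop.map_exact x h hg) (QuotSMulTop.map_surjective x hg) hB.2 hC.2⟩

theorem mem_smul_top_of_exact (hf : Function.Injective f) (h : Function.Exact f g)
    (hg : Function.Surjective g) {rs : List R} (hC : IsWeaklyRegular C rs) {a : A}
    (ha : f a ∈ Ideal.ofList rs • (⊤ : Submodule R B)) :
    a ∈ Ideal.ofList rs • (⊤ : Submodule R A) := by
  have h0 : Function.Exact (0 : PUnit →ₗ[R] A) f := by
    intro y
    rw [← map_zero f, hf.eq_iff]
    exact ⟨fun h ↦ ⟨0, h.symm⟩, fun ⟨_, h⟩ ↦ h.symm⟩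
  have := map_first_exact_on_four_term_right_exact_of_isSMulRegular_last h0 h hg hC
  have h1 := (this (Submodule.Quotient.mk a)).mp
    ((Submodule.Quotient.mk_eq_zero _).mpr ha)
  obtain ⟨z, hz⟩ := h1
  obtain ⟨z, rfl⟩ := Submodule.mkQ_surjective _ z
  exact (Submodule.Quotient.mk_eq_zero _).mp hz.symm

end WeaklyRegular

section IdealSequences

open IsLocalRing

variable {R : Type} [CommRing R] [IsLocalRing R] [IsNoetherianRing R] {n : ℕ} {I : Ideal R}

theorem exists_isWeaklyRegular_of_quotient [IsLocalRing (R ⧸ I)] {m : ℕ}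
    (h : IsGorensteinLocalOfDim (R ⧸ I) m) :
    ∃ rs : List R, rs.length = m ∧ (∀ r ∈ rs, r ∈ maximalIdeal R) ∧
      IsWeaklyRegular (R ⧸ I) rs := by
  obtain ⟨rs, hlen, hmem, hreg⟩ := exists_isWeaklyRegular_of_subsingleton_ext (R ⧸ I) m 1
    one_ne_zero fun i hi ↦ h.subsingleton_ext hi
  obtain ⟨qs, rfl⟩ := List.map_surjective_iff.mpr (Ideal.Quotient.mk_surjective (I := I)) rs
  have : IsLocalHom (Ideal.Quotient.mk I) := .of_surjective _ Ideal.Quotient.mk_surjective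
  refine ⟨qs, by simpa using hlen, fun r hr ↦ ?_,
    (isWeaklyRegular_map_algebraMap_iff (R ⧸ I) _ qs).mp hreg⟩
  have := hmem _ (List.mem_map_of_mem hr)
  rw [pow_one] at this
  rw [mem_maximalIdeal, mem_nonunits_iff] at this ⊢
  exact fun hu ↦ this (hu.map _)

theorem IsGorensteinLocalOfDim.subsingleton_ext_quotient [IsLocalRing (R ⧸ I)] {m : ℕ}
    (h : IsGorensteinLocalOfDim (R ⧸ I) m) {i : ℕ} (hi : i < m) : Subsingleton
      (Abelian.Ext (ModuleCat.of R (ResidueField R)) (ModuleCat.of R (R ⧸ I)) i) := by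
  obtain ⟨rs, rfl, hmem, hreg⟩ := exists_isWeaklyRegular_of_quotient h
  exact (subsingleton_ext_and_nonempty_linearEquiv (ResidueField R) rs
    (fun r hr ↦ mem_annihilator_residueField (hmem r hr)) _ hreg).1 i hi

end IdealSequences

section Choices

open IsLocalRing

variable {R : Type} [CommRing R]

theorem subsingleton_ext_prod {B C : Type} [AddCommGroup B] [Module R B] [AddCommGroup C]
    [Module R C] (N : ModuleCat.{0} R) (i : ℕ)
    (hB : Subsingleton (Abelian.Ext N (ModuleCat.of R B) i))
    (hC : Subsingleton (Abelian.Ext N (ModuleCat.of R C) i)) :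
    Subsingleton (Abelian.Ext N (ModuleCat.of R (B × C)) i) :=
  subsingleton_ext_middle (f := LinearMap.inl R B C) (g := LinearMap.snd R B C)
    LinearMap.inl_injective LinearMap.snd_surjective Function.Exact.inl_snd N i hB hC

variable [IsLocalRing R]

theorem ofList_le_maximalIdeal {rs : List R} (h : ∀ r ∈ rs, r ∈ maximalIdeal R) :
    Ideal.ofList rs ≤ maximalIdeal R :=
  Ideal.span_le.mpr h

theorem isLocalRing_quotient_ofList {rs : List R} (hmem : ∀ r ∈ rs, r ∈ maximalIdeal R) :
    IsLocalRing (R ⧸ Ideal.ofList rs) := by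
  have hne : Ideal.ofList rs ≠ ⊤ := fun h ↦ Ideal.IsPrime.ne_top' (top_le_iff.mp
    (h ▸ ofList_le_maximalIdeal hmem) : maximalIdeal R = ⊤)
  have : Nontrivial (R ⧸ Ideal.ofList rs) := Ideal.Quotient.nontrivial_iff.mpr hne
  exact .of_surjective' (Ideal.Quotient.mk _) Ideal.Quotient.mk_surjective

variable [IsNoetherianRing R]

theorem exists_isWeaklyRegular_self_and_pair (B C : Type) [AddCommGroup B] [Module R B]
    [Module.Finite R B] [AddCommGroup C] [Module R C] [Module.Finite R C] (d K : ℕ) (hK : K ≠ 0)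
    (hR : ∀ i < d, Subsingleton
      (Abelian.Ext (ModuleCat.of R (ResidueField R)) (ModuleCat.of R R) i))
    (hB : ∀ i < d, Subsingleton
      (Abelian.Ext (ModuleCat.of R (ResidueField R)) (ModuleCat.of R B) i))
    (hC : ∀ i < d, Subsingleton
      (Abelian.Ext (ModuleCat.of R (ResidueField R)) (ModuleCat.of R C) i)) :
    ∃ rs : List R, rs.length = d ∧ (∀ r ∈ rs, r ∈ maximalIdeal R ^ K) ∧ IsWeaklyRegular R rs ∧
      IsWeaklyRegular B rs ∧ IsWeaklyRegular C rs := by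
  obtain ⟨rs, hlen, hmem, hreg⟩ := exists_isWeaklyRegular_of_subsingleton_ext (R × (B × C)) d K hK
    fun i hi ↦ subsingleton_ext_prod _ i (hR i hi)
      (subsingleton_ext_prod _ i (hB i hi) (hC i hi))
  have h2 : IsWeaklyRegular (B × C) rs :=
    isWeaklyRegular_of_leftInverse (LinearMap.snd_comp_inr R R (B × C)) hreg
  exact ⟨rs, hlen, hmem, isWeaklyRegular_of_leftInverse (LinearMap.fst_comp_inl R R (B × C)) hreg,
    isWeaklyRegular_of_leftInverse (LinearMap.fst_comp_inl R B C) h2,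
    isWeaklyRegular_of_leftInverse (LinearMap.snd_comp_inr R B C) h2⟩

theorem krullDimLE_zero_quotient_ofList {rs : List R} (hdim : ringKrullDim R = rs.length)
    (hmem : ∀ r ∈ rs, r ∈ maximalIdeal R) (hreg : IsWeaklyRegular R rs) :
    Ring.KrullDimLE 0 (R ⧸ Ideal.ofList rs) := by
  have h := ringKrullDim_add_length_eq_ringKrullDim_of_isRegular rs
    ((isRegular_iff_isWeaklyRegular_of_subset_maximalIdeal hmem).mpr hreg)
  rw [hdim] at h
  rw [Ring.krullDimLE_iff]
  have : ringKrullDim (R ⧸ Ideal.ofList rs) = 0 :=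
    (ENat.WithBot.add_natCast_cancel (c := rs.length)).mp (by rw [h, zero_add])
  exact this.le

theorem exists_pow_mem_ofList {rs : List R} (hdim : ringKrullDim R = rs.length)
    (hmem : ∀ r ∈ rs, r ∈ maximalIdeal R) (hreg : IsWeaklyRegular R rs) {x : R}
    (hx : x ∈ maximalIdeal R) : ∃ N : ℕ, x ^ N ∈ Ideal.ofList rs := by
  have := krullDimLE_zero_quotient_ofList hdim hmem hreg
  have := isLocalRing_quotient_ofList hmem
  have : IsLocalHom (Ideal.Quotient.mk (Ideal.ofList rs)) :=
    .of_surjective _ Ideal.Quotient.mk_surjective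
  have hx' : Ideal.Quotient.mk (Ideal.ofList rs) x ∈ maximalIdeal (R ⧸ Ideal.ofList rs) := by
    rw [mem_maximalIdeal, mem_nonunits_iff] at hx ⊢
    exact fun hu ↦ hx (isUnit_of_map_unit _ _ hu)
  obtain ⟨N, hN⟩ := Ring.KrullDimLE.isNilpotent_iff_mem_maximalIdeal.mpr hx'
  exact ⟨N, by rwa [← map_pow, Ideal.Quotient.eq_zero_iff_mem] at hN⟩

variable {n : ℕ} {I : Ideal R} [IsLocalRing (R ⧸ I)]

theorem exists_mem_isWeaklyRegular_append (hn : 0 < n) (hR : IsGorensteinLocalOfDim R n)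
    (hI : IsGorensteinLocalOfDim (R ⧸ I) (n - 1)) {rs : List R} (hlen : rs.length = n - 1)
    (hmem : ∀ r ∈ rs, r ∈ maximalIdeal R) (hreg : IsWeaklyRegular R rs)
    (hregI : IsWeaklyRegular (R ⧸ I) rs) :
    ∃ w ∈ I, IsWeaklyRegular R (rs ++ [w]) := by
  have hsub := hR.subsingleton_ext (i := rs.length) (by omega)
  obtain ⟨e⟩ := (subsingleton_ext_and_nonempty_linearEquiv (ResidueField R) rs
    (fun r hr ↦ mem_annihilator_residueField (hmem r hr)) R hreg).2
  obtain ⟨x, hx, hxreg⟩ := IsSMulRegular.subsingleton_linearMap_iff.mp e.symm.toEquiv.subsingleton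
  have hxm : x ∈ maximalIdeal R := by
    rw [mem_maximalIdeal, mem_nonunits_iff]
    intro hu
    have h1 := Module.mem_annihilator.mp hx (1 : ResidueField R)
    exact one_ne_zero (hu.smul_eq_zero.mp h1)
  have hloc : IsLocalHom (Ideal.Quotient.mk I) := .of_surjective _ Ideal.Quotient.mk_surjective
  have hmk {r : R} (hr : r ∈ maximalIdeal R) : Ideal.Quotient.mk I r ∈ maximalIdeal (R ⧸ I) := by
    rw [mem_maximalIdeal, mem_nonunits_iff] at hr ⊢
    exact fun hu ↦ hr (isUnit_of_map_unit _ _ hu)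
  obtain ⟨N, hN⟩ := exists_pow_mem_ofList (rs := rs.map (Ideal.Quotient.mk I))
    (by simpa [hlen] using hI.2.1) (by simpa using fun r hr ↦ hmk (hmem r hr))
    ((isWeaklyRegular_map_algebraMap_iff (R ⧸ I) _ rs).mpr hregI) (hmk hxm)
  rw [← Ideal.map_ofList, ← map_pow, ← Ideal.mem_comap,
    Ideal.comap_map_of_surjective' _ Ideal.Quotient.mk_surjective, Ideal.mk_ker,
    Submodule.mem_sup] at hN
  obtain ⟨q, hq, w, hw, hqw⟩ := hN
  refine ⟨w, hw, isWeaklyRegular_append_singleton_iff.mpr ⟨hreg, fun a ha ↦ ?_⟩⟩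
  refine mem_of_isSMulRegular_quotient_of_smul_mem (hxreg.pow N) ?_
  rw [← hqw, add_smul]
  exact add_mem (Submodule.smul_mem_smul hq trivial) ha

theorem subsingleton_ext_quotient_range (hR : IsGorensteinLocalOfDim R n)
    (hI : IsGorensteinLocalOfDim (R ⧸ I) (n - 1)) {s : I →ₗ[R] R} (hs : Function.Injective s)
    {i : ℕ} (hi : i < n - 1) : Subsingleton (Abelian.Ext (ModuleCat.of R (ResidueField R))
      (ModuleCat.of R (R ⧸ LinearMap.range s)) i) := by
  refine subsingleton_ext_right (f := s) (g := Submodule.mkQ _) hs (Submodule.mkQ_surjective _)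
    (LinearMap.exact_map_mkQ_range s) _ i (hR.subsingleton_ext (by omega)) ?_
  exact subsingleton_ext_left (f := Submodule.subtype I) (g := Submodule.mkQ I)
    (Submodule.subtype_injective I) (Submodule.mkQ_surjective _)
    (LinearMap.exact_subtype_mkQ I) _ i (hR.subsingleton_ext (by omega))
    (hI.subsingleton_ext_quotient hi)

end Choices

section SelfInjective

open IsLocalRing

variable {A : Type} [CommRing A]

theorem length_hom_le_add {X : Type} [AddCommGroup X] [Module A X] {M : Type} [AddCommGroup M]
    [Module A M] (N : Submodule A M) :
    Module.length A (M →ₗ[A] X) ≤ Module.length A ((M ⧸ N) →ₗ[A] X) +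
      Module.length A (LinearMap.range (LinearMap.lcomp A X N.subtype)) := by
  let ρ := LinearMap.lcomp A X N.subtype
  refine (Module.length_eq_add_of_exact (LinearMap.lcomp A X N.mkQ) ρ.rangeRestrict ?_
    ρ.surjective_rangeRestrict ?_).le
  · exact LinearMap.lcomp_injective_of_surjective _ N.mkQ_surjective
  · intro f
    exact Subtype.ext_iff.trans
      (LinearMap.exact_lcomp_of_exact_of_surjective X (LinearMap.exact_subtype_mkQ N)
        N.mkQ_surjective f)

variable [IsLocalRing A]

theorem HasSimpleSocle.length_hom_le {X : Type} [AddCommGroup X] [Module A X]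
    (h : HasSimpleSocle A X) {M : Type} [AddCommGroup M] [Module A M]
    (hM : IsFiniteLength A M) : Module.length A (M →ₗ[A] X) ≤ Module.length A M := by
  induction hM with
  | of_subsingleton => simp
  | @of_simple_quotient M _ _ N hsimple _ ih =>
    obtain ⟨m, hm, ⟨e⟩⟩ := isSimpleModule_iff_quot_maximal.mp hsimple
    obtain rfl := eq_maximalIdeal hm
    obtain ⟨e2⟩ := hasSimpleSocle_iff.mp h
    have h1 : Module.length A ((M ⧸ N) →ₗ[A] X) = Module.length A (M ⧸ N) :=
      ((LinearEquiv.congrLeft X A e).trans (e2.trans e.symm)).length_eq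
    rw [Module.length_eq_add_of_exact N.subtype N.mkQ N.subtype_injective N.mkQ_surjective
      (LinearMap.exact_subtype_mkQ N), add_comm (Module.length A N), ← h1]
    exact (length_hom_le_add N).trans (by
      gcongr
      exact (Module.length_le_of_injective _ (Submodule.subtype_injective _)).trans ih)

theorem HasSimpleSocle.injective [IsArtinianRing A] (h : HasSimpleSocle A A) :
    Module.Injective A A := by
  refine Module.Baer.injective (Module.Baer.iff_surjective.mpr fun K ↦ ?_)
  have hfin (M : Type) [AddCommGroup M] [Module A M] [Module.Finite A M] : IsFiniteLength A M :=
    isFiniteLength_iff_isNoetherian_isArtinian.mpr ⟨inferInstance, inferInstance⟩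
  set ρ := LinearMap.lcomp A A K.subtype
  have hfg : Module.Finite A K := inferInstance
  have h1 := length_hom_le_add (X := A) K
  rw [(LinearMap.ringLmapEquivSelf A A A).length_eq,
    Module.length_eq_add_of_exact K.subtype K.mkQ K.subtype_injective K.mkQ_surjective
      (LinearMap.exact_subtype_mkQ K), add_comm (Module.length A K)] at h1
  have h2 := h1.trans (add_le_add_left (h.length_hom_le (hfin (A ⧸ K))) _)
  have h3 := (ENat.add_le_add_iff_left (Module.length_ne_top_iff.mpr (hfin (A ⧸ K)))).mp h2
  have h4 := (h.length_hom_le (hfin K)).trans h3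
  rw [← LinearMap.range_eq_top]
  by_contra hne
  have : IsNoetherian A (K →ₗ[A] A) := inferInstance
  have : IsArtinian A (K →ₗ[A] A) := inferInstance
  exact (Submodule.length_lt hne).not_ge h4

/-- In an Artinian local ring with simple socle, an element killed by the annihilator of an
ideal belongs to the ideal. -/
theorem HasSimpleSocle.exists_mul_ne_zero [IsArtinianRing A] (h : HasSimpleSocle A A)
    {I : Ideal A} {c : A} (hc : c ∉ I) : ∃ b : A, (∀ a ∈ I, b * a = 0) ∧ b * c ≠ 0 := by
  have hinj := h.injective
  obtain ⟨u, hu0, hu, -⟩ := h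
  let L : Ideal A := Submodule.comap (LinearMap.toSpanSingleton A A c) I
  have hL : L ≤ maximalIdeal A := le_maximalIdeal fun htop ↦ hc (by
    have : (1 : A) ∈ L := htop ▸ trivial
    simpa [L] using this)
  let i : (A ⧸ L) →ₗ[A] A ⧸ I := Submodule.mapQ L I (LinearMap.toSpanSingleton A A c) le_rfl
  have hi : Function.Injective i := by
    rw [← LinearMap.ker_eq_bot, Submodule.ker_mapQ]
    exact Submodule.mkQ_map_self L
  let φ : (A ⧸ L) →ₗ[A] A := Submodule.liftQ L (LinearMap.toSpanSingleton A A u)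
    fun r hr ↦ by simpa using hu r (hL hr)
  obtain ⟨ψ, hψ⟩ := hinj.out i hi φ
  refine ⟨ψ (Submodule.Quotient.mk 1), fun a ha ↦ ?_, ?_⟩
  · rw [mul_comm, ← smul_eq_mul, ← map_smul, ← Submodule.Quotient.mk_smul, smul_eq_mul, mul_one,
      (Submodule.Quotient.mk_eq_zero I).mpr ha, map_zero]
  · rw [mul_comm, ← smul_eq_mul, ← map_smul, ← Submodule.Quotient.mk_smul, smul_eq_mul, mul_one]
    have h1 : i (Submodule.Quotient.mk 1) = Submodule.Quotient.mk c := by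
      exact (Submodule.mapQ_apply _ _ _ _).trans (by simp)
    have h2 : φ (Submodule.Quotient.mk 1) = u := 
      (Submodule.liftQ_apply _ _ _).trans (by simp)
    rw [← h1, hψ, h2]
    exact hu0

end SelfInjective

section Quotients

open IsLocalRing

variable {R : Type} [CommRing R]

theorem exists_extension_to_quotient (𝔞 : Ideal R) [Module.Injective (R ⧸ 𝔞) (R ⧸ 𝔞)]
    {F : Type} [AddCommGroup F] [Module R F] (K : Submodule R F)
    (hK : ∀ x : K, (x : F) ∈ 𝔞 • (⊤ : Submodule R F) → x ∈ 𝔞 • (⊤ : Submodule R K)) :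
    Function.Surjective (LinearMap.lcomp R (R ⧸ 𝔞) K.subtype) := by
  intro f
  have hf : 𝔞 • (⊤ : Submodule R K) ≤ LinearMap.ker f := by
    rw [Submodule.smul_le]
    intro r hr x _
    rw [LinearMap.mem_ker, map_smul, Algebra.smul_def]
    exact mul_eq_zero_of_left (Ideal.Quotient.eq_zero_iff_mem.mpr hr) _
  have hi : 𝔞 • (⊤ : Submodule R K) ≤ (𝔞 • (⊤ : Submodule R F)).comap K.subtype := by
    rw [Submodule.smul_le]
    exact fun r hr x _ ↦ Submodule.smul_mem_smul hr trivial
  let f' := ((𝔞 • (⊤ : Submodule R K)).liftQ f hf).extendScalarsOfSurjective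
    (S := R ⧸ 𝔞) Ideal.Quotient.mk_surjective
  let i' := ((𝔞 • (⊤ : Submodule R K)).mapQ (𝔞 • (⊤ : Submodule R F))
    K.subtype hi).extendScalarsOfSurjective (S := R ⧸ 𝔞) Ideal.Quotient.mk_surjective
  have hi' : Function.Injective i' := by
    rw [injective_iff_map_eq_zero]
    intro x hx
    obtain ⟨x, rfl⟩ := Submodule.mkQ_surjective _ x
    exact (Submodule.Quotient.mk_eq_zero _).mpr
      (hK x ((Submodule.Quotient.mk_eq_zero _).mp hx))
  obtain ⟨h, hh⟩ := Module.Injective.out i' hi' f'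
  refine ⟨h.restrictScalars R ∘ₗ Submodule.mkQ _, LinearMap.ext fun x ↦ ?_⟩
  exact hh (Submodule.Quotient.mk x)

variable [IsLocalRing R]

theorem HasSimpleSocle.congr {X Y : Type} [AddCommGroup X] [Module R X] [AddCommGroup Y]
    [Module R Y] (e : X ≃ₗ[R] Y) (h : HasSimpleSocle R X) : HasSimpleSocle R Y := by
  obtain ⟨e2⟩ := hasSimpleSocle_iff.mp h
  exact hasSimpleSocle_iff.mpr ⟨(LinearEquiv.congrRight e).symm.trans e2⟩

theorem mk_mem_maximalIdeal_iff {𝔞 : Ideal R} [IsLocalRing (R ⧸ 𝔞)] {r : R} :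
    Ideal.Quotient.mk 𝔞 r ∈ maximalIdeal (R ⧸ 𝔞) ↔ r ∈ maximalIdeal R := by
  have : IsLocalHom (Ideal.Quotient.mk 𝔞) := .of_surjective _ Ideal.Quotient.mk_surjective
  simp [mem_maximalIdeal, mem_nonunits_iff]

theorem hasSimpleSocle_quotient_iff {𝔞 : Ideal R} [IsLocalRing (R ⧸ 𝔞)] {X : Type}
    [AddCommGroup X] [Module R X] [Module (R ⧸ 𝔞) X] [IsScalarTower R (R ⧸ 𝔞) X] :
    HasSimpleSocle (R ⧸ 𝔞) X ↔ HasSimpleSocle R X := by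
  have h (r : R) (v : X) : Ideal.Quotient.mk 𝔞 r • v = r • v := algebraMap_smul (R ⧸ 𝔞) r v
  simp only [HasSimpleSocle, Ideal.Quotient.mk_surjective.forall,
    Ideal.Quotient.mk_surjective.exists, mk_mem_maximalIdeal_iff, h]

end Quotients

section Lifting

open IsLocalRing

variable {R : Type} [CommRing R]

theorem exists_smul_eq_of_mkQ_comp_eq_zero {N B : Type} [AddCommGroup N] [Module R N]
    [AddCommGroup B] [Module R B] {x : R} (hx : IsSMulRegular B x) (h : N →ₗ[R] B)
    (h0 : ∀ v, (Submodule.Quotient.mk (h v) : QuotSMulTop x B) = 0) :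
    ∃ φ : N →ₗ[R] B, x • φ = h := by
  have hinj : Function.Injective (LinearMap.lsmul R B x) := hx
  have hmem (v : N) : h v ∈ LinearMap.range (LinearMap.lsmul R B x) := by
    obtain ⟨b, -, hb⟩ := (Submodule.Quotient.mk_eq_zero _).mp (h0 v)
    exact ⟨b, hb⟩
  refine ⟨(LinearEquiv.ofInjective _ hinj).symm.toLinearMap ∘ₗ h.codRestrict _ hmem, ?_⟩
  ext v
  exact congrArg Subtype.val ((LinearEquiv.ofInjective _ hinj).apply_symm_apply
    (h.codRestrict _ hmem v))

theorem lcomp_surjective_congr {K F X Y : Type} [AddCommGroup K] [Module R K] [AddCommGroup F]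
    [Module R F] [AddCommGroup X] [Module R X] [AddCommGroup Y] [Module R Y] (e : X ≃ₗ[R] Y)
    {i : K →ₗ[R] F} (h : Function.Surjective (LinearMap.lcomp R X i)) :
    Function.Surjective (LinearMap.lcomp R Y i) := by
  intro f
  obtain ⟨g, hg⟩ := h (e.symm.toLinearMap ∘ₗ f)
  refine ⟨e.toLinearMap ∘ₗ g, LinearMap.ext fun x ↦ ?_⟩
  have := LinearMap.congr_fun hg x
  simpa using congrArg e this

variable [IsLocalRing R] [IsNoetherianRing R]

/-- Let `P = F / K` with `F` finite projective.  If every map `K → B / (rs) B` extends to `F`,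
then the same holds for maps `K → B`, and every map `P → B / (rs) B` lifts to `B`. -/
theorem lcomp_surjective_and_exists_lift {F P : Type} [AddCommGroup F] [Module R F]
    [Module.Finite R F] [Module.Projective R F] [AddCommGroup P] [Module R P]
    {π : F →ₗ[R] P} (hπ : Function.Surjective π) (rs : List R)
    (hmem : ∀ r ∈ rs, r ∈ maximalIdeal R) (B : Type) [AddCommGroup B] [Module R B]
    [Module.Finite R B] (hreg : IsWeaklyRegular B rs)
    (hext : Function.Surjective (LinearMap.lcomp R (B ⧸ (Ideal.ofList rs • (⊤ : Submodule R B)))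
      (LinearMap.ker π).subtype)) :
    Function.Surjective (LinearMap.lcomp R B (LinearMap.ker π).subtype) ∧
    ∀ g : P →ₗ[R] B ⧸ (Ideal.ofList rs • (⊤ : Submodule R B)),
      ∃ h : P →ₗ[R] B, Submodule.mkQ _ ∘ₗ h = g := by
  induction rs generalizing B with
  | nil =>
    let e : (B ⧸ (Ideal.ofList ([] : List R) • (⊤ : Submodule R B))) ≃ₗ[R] B :=
      Submodule.quotEquivOfEqBot _ (by simp)
    refine ⟨lcomp_surjective_congr e hext, fun g ↦ ⟨e.toLinearMap ∘ₗ g, LinearMap.ext fun v ↦ ?_⟩⟩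
    exact e.symm_apply_apply (g v)
  | cons x rs ih =>
    rw [isWeaklyRegular_cons_iff] at hreg
    obtain ⟨hx, hreg⟩ := hreg
    let e := Submodule.quotOfListConsSMulTopEquivQuotSMulTopInner B x rs
    obtain ⟨ih1, ih2⟩ := ih (fun r hr ↦ hmem r (by simp [hr])) (QuotSMulTop x B) hreg
      (lcomp_surjective_congr e hext)
    have hsurj : Function.Surjective (LinearMap.lcomp R B (LinearMap.ker π).subtype) := by
      rw [← LinearMap.range_eq_top, eq_top_iff]
      refine Submodule.le_of_le_smul_of_le_jacobson_bot (I := maximalIdeal R)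
        Module.Finite.fg_top (maximalIdeal_le_jacobson _) fun f _ ↦ ?_
      obtain ⟨g', hg'⟩ := ih1 (Submodule.mkQ _ ∘ₗ f)
      obtain ⟨g, hg⟩ := Module.projective_lifting_property (Submodule.mkQ _) g'
        (Submodule.mkQ_surjective _)
      obtain ⟨φ, hφ⟩ := exists_smul_eq_of_mkQ_comp_eq_zero hx
        (f - g ∘ₗ (LinearMap.ker π).subtype) fun v ↦ by
          have h1 := LinearMap.congr_fun hg' v
          have h2 := LinearMap.congr_fun hg (v : F)
          simp only [LinearMap.lcomp_apply, LinearMap.comp_apply, Submodule.mkQ_apply] at h1 h2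
          simp only [LinearMap.sub_apply, LinearMap.comp_apply, Submodule.Quotient.mk_sub, ← h1]
          rw [sub_eq_zero]
          exact h2.symm
      have : f = g ∘ₗ (LinearMap.ker π).subtype + x • φ := by rw [hφ]; abel
      rw [this]
      exact Submodule.add_mem_sup ⟨g, rfl⟩
        (Submodule.smul_mem_smul (hmem x (by simp)) trivial)
    refine ⟨hsurj, fun g ↦ ?_⟩
    obtain ⟨h', hh'⟩ := ih2 (e.toLinearMap ∘ₗ g)
    obtain ⟨ψ, hψ⟩ := Module.projective_lifting_property (Submodule.mkQ _) (h' ∘ₗ π)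
      (Submodule.mkQ_surjective _)
    obtain ⟨φ, hφ⟩ := exists_smul_eq_of_mkQ_comp_eq_zero hx
      (ψ ∘ₗ (LinearMap.ker π).subtype) fun v ↦ by
        have h2 := LinearMap.congr_fun hψ (v : F)
        rw [LinearMap.comp_apply, LinearMap.comp_apply, LinearMap.mem_ker.mp v.2, map_zero] at h2
        exact h2
    obtain ⟨θ, hθ⟩ := hsurj φ
    have hker : LinearMap.ker π ≤ LinearMap.ker (ψ - x • θ) := by
      intro v hv
      have h1 := LinearMap.congr_fun hφ ⟨v, hv⟩
      have h2 := LinearMap.congr_fun hθ ⟨v, hv⟩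
      simp only [LinearMap.lcomp_apply, LinearMap.smul_apply, LinearMap.comp_apply,
        Submodule.subtype_apply] at h1 h2
      simp [← h1, ← h2]
    let k : P →ₗ[R] B := (LinearMap.ker π).liftQ (ψ - x • θ) hker ∘ₗ
      (π.quotKerEquivOfSurjective hπ).symm.toLinearMap
    have hk (v : F) : k (π v) = ψ v - x • θ v := by
      have : (π.quotKerEquivOfSurjective hπ).symm (π v) = Submodule.Quotient.mk v :=
        (LinearEquiv.symm_apply_eq _).mpr rfl
      simp only [k, LinearMap.comp_apply, LinearEquiv.coe_coe, this]
      rfl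
    refine ⟨k, LinearMap.ext fun p ↦ e.injective ?_⟩
    obtain ⟨v, rfl⟩ := hπ p
    have h1 : (Submodule.Quotient.mk (k (π v)) : QuotSMulTop x B) = h' (π v) := by
      have h2 := LinearMap.congr_fun hψ v
      rw [hk, Submodule.Quotient.mk_sub, (Submodule.Quotient.mk_eq_zero _).mpr
        (Submodule.smul_mem_pointwise_smul (θ v) x ⊤ trivial), sub_zero]
      exact h2
    have h3 := LinearMap.congr_fun hh' (π v)
    simp only [LinearMap.comp_apply, ← h1] at h3
    exact h3

end Lifting

section Core

open IsLocalRing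

variable {R : Type} [CommRing R] {n : ℕ} {I : Ideal R}

theorem isWeaklyRegular_ideal_append {rs : List R} {w : R} (hreg : IsWeaklyRegular R (rs ++ [w]))
    (hregI : IsWeaklyRegular (R ⧸ I) rs) : IsWeaklyRegular I (rs ++ [w]) := by
  rw [isWeaklyRegular_append_singleton_iff] at hreg ⊢
  refine ⟨isWeaklyRegular_of_exact (Submodule.subtype_injective I) (LinearMap.exact_subtype_mkQ I)
    (Submodule.mkQ_surjective I) hreg.1 hregI, fun x hx ↦ ?_⟩
  refine mem_smul_top_of_exact (Submodule.subtype_injective I) (LinearMap.exact_subtype_mkQ I)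
    (Submodule.mkQ_surjective I) hregI (hreg.2 _ ?_)
  have := Submodule.mem_map_of_mem (f := I.subtype) hx
  rw [Submodule.map_smul''] at this
  exact Submodule.smul_mono le_rfl le_top this

theorem mul_apply_comm (s : I →ₗ[R] R) (a b : I) : (a : R) * s b = b * s a := by
  rw [← smul_eq_mul, ← map_smul, ← smul_eq_mul, ← map_smul]
  exact congrArg s (Subtype.ext (mul_comm _ _))

variable [IsLocalRing R]

/-- The quotient of a Gorenstein local ring by a maximal regular sequence has simple socle. -/
theorem IsGorensteinLocalOfDim.hasSimpleSocle_quotient_ofList (hR : IsGorensteinLocalOfDim R n) {rs : List R} (hlen : rs.length = n)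
    (hmem : ∀ r ∈ rs, r ∈ maximalIdeal R) (hreg : IsWeaklyRegular R rs) :
    HasSimpleSocle R (R ⧸ Ideal.ofList rs) :=
  (hR.hasSimpleSocle hmem hreg hlen).congr
    (Submodule.quotEquivOfEq _ _ (by rw [smul_eq_mul, Ideal.mul_top]))

variable [IsNoetherianRing R]

/-- Over a Gorenstein local ring `R`, if a maximal regular sequence `rs` of `R` is regular on the
finite module `P`, then every map `P → R / (rs)` lifts to `R`. -/
theorem exists_lift_of_isWeaklyRegular (hR : IsGorensteinLocalOfDim R n) {rs : List R}
    (hlen : rs.length = n) (hmem : ∀ r ∈ rs, r ∈ maximalIdeal R) (hreg : IsWeaklyRegular R rs)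
    {P : Type} [AddCommGroup P] [Module R P] [Module.Finite R P] (hP : IsWeaklyRegular P rs)
    (g : P →ₗ[R] R ⧸ Ideal.ofList rs) :
    ∃ h : P →ₗ[R] R, ∀ x, Ideal.Quotient.mk (Ideal.ofList rs) (h x) = g x := by
  obtain ⟨m, π, hπ⟩ := Module.Finite.exists_fin' R P
  have hloc := isLocalRing_quotient_ofList hmem
  have := krullDimLE_zero_quotient_ofList (hlen ▸ hR.2.1) hmem hreg
  have : IsArtinianRing (R ⧸ Ideal.ofList rs) := isArtinianRing_iff_krullDimLE_zero.mpr this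
  have := HasSimpleSocle.injective
    (hasSimpleSocle_quotient_iff.mpr (hR.hasSimpleSocle_quotient_ofList hlen hmem hreg))
  have hext := exists_extension_to_quotient (Ideal.ofList rs) (LinearMap.ker π) fun x hx ↦
    mem_smul_top_of_exact (Submodule.subtype_injective _) (LinearMap.exact_subtype_ker_map π)
      hπ hP hx
  have heq : Ideal.ofList rs • (⊤ : Submodule R R) = Ideal.ofList rs := by
    rw [smul_eq_mul, Ideal.mul_top]
  let e := Submodule.quotEquivOfEq _ _ heq
  obtain ⟨h, hh⟩ := (lcomp_surjective_and_exists_lift hπ rs hmem R hreg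
    (lcomp_surjective_congr e.symm hext)).2 (e.symm.toLinearMap ∘ₗ g)
  exact ⟨h, fun x ↦ e.symm.injective (LinearMap.congr_fun hh x)⟩

/-- If `r ι ≡ c s` modulo a regular sequence `rs` of colength one, then `r ∈ J + (rs)`, where
`J` is the image of `s`. -/
theorem mem_range_sup_ofList_of_mul_sub_mem (hR : IsGorensteinLocalOfDim R n) {rs : List R}
    {w : R} (hlen : (rs ++ [w]).length = n) (hmem : ∀ r ∈ rs ++ [w], r ∈ maximalIdeal R)
    (hreg : IsWeaklyRegular R (rs ++ [w])) (hregI : IsWeaklyRegular (R ⧸ I) rs) (hw : w ∈ I)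
    {s : I →ₗ[R] R} (hgen : ∀ f : I →ₗ[R] R, ∃ p q : R, f = p • I.subtype + q • s) {r c : R}
    (h : ∀ a : I, r * a - c * s a ∈ Ideal.ofList rs) :
    r ∈ LinearMap.range s ⊔ Ideal.ofList rs := by
  have hloc := isLocalRing_quotient_ofList hmem
  have := krullDimLE_zero_quotient_ofList (hlen ▸ hR.2.1) hmem hreg
  have : IsArtinianRing (R ⧸ Ideal.ofList (rs ++ [w])) :=
    isArtinianRing_iff_krullDimLE_zero.mpr this
  have hsoc : HasSimpleSocle (R ⧸ Ideal.ofList (rs ++ [w])) (R ⧸ Ideal.ofList (rs ++ [w])) :=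
    hasSimpleSocle_quotient_iff.mpr (hR.hasSimpleSocle_quotient_ofList hlen hmem hreg)
  have heq : Ideal.ofList rs • (⊤ : Submodule R R) = Ideal.ofList rs := by
    rw [smul_eq_mul, Ideal.mul_top]
  have happ : Ideal.ofList (rs ++ [w]) = Ideal.ofList rs ⊔ Ideal.span {w} := by
    rw [Ideal.ofList_append, Ideal.ofList_singleton]
  have hle : Ideal.ofList rs ≤ Ideal.ofList (rs ++ [w]) := happ ▸ le_sup_left
  have hwmem : w ∈ Ideal.ofList (rs ++ [w]) := happ ▸ Submodule.mem_sup_right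
    (Ideal.mem_span_singleton_self w)
  have hwreg : ∀ x : R, w * x ∈ Ideal.ofList rs → x ∈ Ideal.ofList rs := by
    simpa only [heq, smul_eq_mul] using (isWeaklyRegular_append_singleton_iff.mp hreg).2
  have hc : c ∈ I ⊔ Ideal.ofList rs := by
    by_contra hc
    have hc' : Ideal.Quotient.mk (Ideal.ofList (rs ++ [w])) c ∉
        I.map (Ideal.Quotient.mk (Ideal.ofList (rs ++ [w]))) := by
      rw [← Ideal.mem_comap, Ideal.comap_map_of_surjective' _ Ideal.Quotient.mk_surjective,
        Ideal.mk_ker, happ, sup_comm (Ideal.ofList rs), ← sup_assoc,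
        sup_eq_left.mpr ((Ideal.span_singleton_le_iff_mem I).mpr hw)]
      exact hc
    obtain ⟨b, hb, hbc⟩ := hsoc.exists_mul_ne_zero hc'
    obtain ⟨b, rfl⟩ := Ideal.Quotient.mk_surjective b
    have hbI (a : I) : b * a ∈ Ideal.ofList (rs ++ [w]) := by
      rw [← Ideal.Quotient.eq_zero_iff_mem, map_mul]
      exact hb _ (Ideal.mem_map_of_mem _ a.2)
    have hwreg' : IsSMulRegular (R ⧸ Ideal.ofList rs) w :=
      (isSMulRegular_quotient_iff_mem_of_smul_mem _ _).mpr hwreg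
    obtain ⟨φ, hφ⟩ := exists_smul_eq_of_mkQ_comp_eq_zero hwreg'
      (b • (Submodule.mkQ (Ideal.ofList rs) ∘ₗ I.subtype)) fun a ↦ by
        obtain ⟨q, hq, v, hv, hqv⟩ := Submodule.mem_sup.mp (happ ▸ hbI a)
        obtain ⟨u, rfl⟩ := Ideal.mem_span_singleton.mp hv
        refine (Submodule.Quotient.mk_eq_zero _).mpr ⟨Submodule.Quotient.mk u, trivial, ?_⟩
        refine (Submodule.Quotient.eq _).mpr ?_
        have : w * u - b * a = - q := by rw [← hqv]; ring
        simpa [this] using hq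
    obtain ⟨f, hf⟩ := exists_lift_of_isWeaklyRegular hR hlen hmem hreg
      (isWeaklyRegular_ideal_append hreg hregI) (Submodule.factor hle ∘ₗ φ)
    obtain ⟨p, q, rfl⟩ := hgen f
    have hφw : φ ⟨w, hw⟩ = Submodule.Quotient.mk b := by
      refine hwreg' ((LinearMap.congr_fun hφ ⟨w, hw⟩).trans ?_)
      refine congrArg Submodule.Quotient.mk (mul_comm b w)
    have hfw := hf ⟨w, hw⟩
    rw [LinearMap.comp_apply, hφw] at hfw
    have hfw' : p * w + q * s ⟨w, hw⟩ - b ∈ Ideal.ofList (rs ++ [w]) :=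
      Ideal.Quotient.eq.mp hfw
    apply hbc
    rw [← map_mul, Ideal.Quotient.eq_zero_iff_mem]
    have e : b * c = (c * p + q * r) * w - q * (r * w - c * s ⟨w, hw⟩)
      - c * (p * w + q * s ⟨w, hw⟩ - b) := by ring
    rw [e]
    exact sub_mem (sub_mem (Ideal.mul_mem_left _ _ hwmem)
      (Ideal.mul_mem_left _ _ (hle (h ⟨w, hw⟩)))) (Ideal.mul_mem_left _ _ hfw')
  obtain ⟨i, hi, q, hq, rfl⟩ := Submodule.mem_sup.mp hc
  refine Submodule.mem_sup.mpr ⟨s ⟨i, hi⟩, ⟨_, rfl⟩, r - s ⟨i, hi⟩, hwreg _ ?_, by ring⟩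
  have e : w * (r - s ⟨i, hi⟩) = (r * w - (i + q) * s ⟨w, hw⟩) + q * s ⟨w, hw⟩ := by
    have := mul_apply_comm s ⟨w, hw⟩ ⟨i, hi⟩
    simp only at this
    linear_combination -this
  rw [e]
  exact add_mem (h ⟨w, hw⟩) (Ideal.mul_mem_right _ _ hq)

end Core

section Unprojection

open IsLocalRing

variable {R : Type} [CommRing R] {I : Ideal R} {s : I →ₗ[R] R}

theorem exists_smul_add_smul_of_span_eq_top {M : Type} [AddCommGroup M] [Module R M] {x y : M}
    (h : Submodule.span R {(Submodule.Quotient.mk y : M ⧸ Submodule.span R {x})} = ⊤) (f : M) :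
    ∃ p q : R, f = p • x + q • y := by
  have hf : (Submodule.Quotient.mk f : M ⧸ Submodule.span R {x}) ∈
    Submodule.span R {Submodule.Quotient.mk y} := h ▸ Submodule.mem_top
  obtain ⟨q, hq⟩ := Submodule.mem_span_singleton.mp hf
  rw [← Submodule.Quotient.mk_smul, eq_comm, Submodule.Quotient.eq,
    Submodule.mem_span_singleton] at hq
  obtain ⟨p, hp⟩ := hq
  exact ⟨p, q, by rw [hp]; abel⟩

theorem inverseHom_apply (hs : Function.Injective s) (a : I) (h : s a ∈ LinearMap.range s) :
    inverseHom R I s hs ⟨s a, h⟩ = a :=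
  congrArg Subtype.val ((LinearEquiv.ofInjective s hs).symm_apply_apply a)

theorem smul_mk_inverseHom_eq_zero_iff (hs : Function.Injective s) (r : R) :
    r • (Submodule.Quotient.mk (inverseHom R I s hs) :
      ((LinearMap.range s : Ideal R) →ₗ[R] R) ⧸
        Submodule.span R {Submodule.subtype (LinearMap.range s : Ideal R)}) = 0 ↔
      ∃ c : R, ∀ a : I, r * a = c * s a := by
  rw [← Submodule.Quotient.mk_smul, Submodule.Quotient.mk_eq_zero, Submodule.mem_span_singleton]
  refine exists_congr fun c ↦ ⟨fun h a ↦ ?_, fun h ↦ LinearMap.ext ?_⟩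
  · exact (congrArg (r * ·) (inverseHom_apply hs a ⟨a, rfl⟩)).symm.trans
      (LinearMap.congr_fun h ⟨s a, a, rfl⟩).symm
  · rintro ⟨_, a, rfl⟩
    exact (h a).symm.trans (congrArg (r * ·) (inverseHom_apply hs a ⟨a, rfl⟩)).symm

theorem span_mk_inverseHom_eq_top (hs : Function.Injective s)
    (hgen : ∀ f : I →ₗ[R] R, ∃ p q : R, f = p • I.subtype + q • s) :
    Submodule.span R
      {(Submodule.Quotient.mk (inverseHom R I s hs) :
          ((LinearMap.range s : Ideal R) →ₗ[R] R) ⧸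
            Submodule.span R {Submodule.subtype (LinearMap.range s : Ideal R)})} = ⊤ := by
  rw [eq_top_iff]
  intro x _
  obtain ⟨f, rfl⟩ := Submodule.Quotient.mk_surjective _ x
  obtain ⟨p, q, h⟩ := hgen (f ∘ₗ s.rangeRestrict)
  refine Submodule.mem_span_singleton.mpr ⟨p, ?_⟩
  rw [← Submodule.Quotient.mk_smul, Submodule.Quotient.eq, Submodule.mem_span_singleton]
  refine ⟨-q, LinearMap.ext ?_⟩
  rintro ⟨_, a, rfl⟩
  have h1 : f ⟨s a, a, rfl⟩ = p * a + q * s a := LinearMap.congr_fun h a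
  have h2 : inverseHom R I s hs ⟨s a, a, rfl⟩ = a := inverseHom_apply hs a ⟨a, rfl⟩
  change -q * s a = p * inverseHom R I s hs ⟨s a, a, rfl⟩ - f ⟨s a, a, rfl⟩
  rw [h1, h2]
  ring

theorem isPrincipal_of_range_eq_top (hs : Function.Injective s) (h : LinearMap.range s = ⊤) :
    I.IsPrincipal := by
  obtain ⟨x, hx⟩ := LinearMap.range_eq_top.mp h 1
  refine ⟨x, le_antisymm (fun a ha ↦ ?_) ((Ideal.span_singleton_le_iff_mem I).mpr x.2)⟩
  refine Submodule.mem_span_singleton.mpr ⟨s ⟨a, ha⟩, ?_⟩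
  have h2 : s (s ⟨a, ha⟩ • x) = s ⟨a, ha⟩ := by rw [map_smul, hx, smul_eq_mul, mul_one]
  exact congrArg Subtype.val (hs h2)

variable [IsLocalRing R]

theorem mem_maximalIdeal_of_mem_append {rs : List R} {w : R} (hI : I ≠ ⊤)
    (hmem : ∀ r ∈ rs, r ∈ maximalIdeal R) (hw : w ∈ I) :
    ∀ r ∈ rs ++ [w], r ∈ maximalIdeal R := by
  simpa [or_imp, forall_and] using ⟨hmem, le_maximalIdeal hI hw⟩

variable [IsNoetherianRing R]

theorem mem_of_forall_mem_sup_maximalIdeal_pow {J : Ideal R} {r : R}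
    (h : ∀ k : ℕ, r ∈ J ⊔ maximalIdeal R ^ (k + 1)) : r ∈ J := by
  have hbot := Ideal.iInf_pow_smul_eq_bot_of_isLocalRing (M := R ⧸ J) (maximalIdeal R)
    Ideal.IsPrime.ne_top'
  rw [← Ideal.Quotient.eq_zero_iff_mem, ← Submodule.mem_bot R, ← hbot, Submodule.mem_iInf]
  intro k
  obtain ⟨j, hj, q, hq, rfl⟩ := Submodule.mem_sup.mp (h k)
  rw [map_add, Ideal.Quotient.eq_zero_iff_mem.mpr hj, zero_add]
  have := Submodule.smul_mem_smul (Ideal.pow_le_pow_right k.le_succ hq)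
    (Submodule.mem_top (R := R) (x := (1 : R ⧸ J)))
  rwa [Algebra.smul_def, mul_one] at this

variable {n : ℕ} [IsLocalRing (R ⧸ I)]

theorem mem_range_iff_exists_mul_eq (hn : 0 < n) (hI : I ≠ ⊤)
    (hGR : IsGorensteinLocalOfDim R n) (hGRI : IsGorensteinLocalOfDim (R ⧸ I) (n - 1))
    (hgen : ∀ f : I →ₗ[R] R, ∃ p q : R, f = p • I.subtype + q • s) (r : R) :
    (∃ c : R, ∀ a : I, r * a = c * s a) ↔ r ∈ LinearMap.range s := by
  constructor
  · rintro ⟨c, hc⟩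
    refine mem_of_forall_mem_sup_maximalIdeal_pow fun k ↦ ?_
    obtain ⟨rs, hlen, hmem, hreg, hregI, -⟩ := exists_isWeaklyRegular_self_and_pair (R := R)
      (R ⧸ I) R (n - 1) (k + 1) k.succ_ne_zero (fun i hi ↦ hGR.subsingleton_ext (by omega))
      (fun i hi ↦ hGRI.subsingleton_ext_quotient hi)
      (fun i hi ↦ hGR.subsingleton_ext (by omega))
    have hmem' (r : R) (hr : r ∈ rs) : r ∈ maximalIdeal R :=
      Ideal.pow_le_self k.succ_ne_zero (hmem r hr)
    obtain ⟨w, hw, hregw⟩ := exists_mem_isWeaklyRegular_append hn hGR hGRI hlen hmem' hreg hregI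
    refine sup_le_sup_left (Ideal.span_le.mpr hmem) _
      (mem_range_sup_ofList_of_mul_sub_mem hGR (by simp; omega)
        (mem_maximalIdeal_of_mem_append hI hmem' hw) hregw hregI hw hgen (c := c) fun a ↦ ?_)
    rw [hc a, sub_self]
    exact zero_mem _
  · rintro ⟨i, rfl⟩
    exact ⟨i, fun a ↦ by rw [mul_apply_comm, mul_comm]⟩

end Unprojection

section Conclusion

open IsLocalRing

open scoped nonZeroDivisors

variable {R : Type} [CommRing R] {I J : Ideal R} {n : ℕ}

theorem isWeaklyRegular_append_apply {rs : List R} {w : R}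
    (hreg : IsWeaklyRegular R (rs ++ [w])) (hw : w ∈ I) {s : I →ₗ[R] R}
    (hs : Function.Injective s) (hregJ : IsWeaklyRegular (R ⧸ LinearMap.range s) rs) :
    IsWeaklyRegular R (rs ++ [s ⟨w, hw⟩]) := by
  rw [isWeaklyRegular_append_singleton_iff] at hreg ⊢
  refine ⟨hreg.1, fun b hb ↦ hreg.2 b ?_⟩
  have h1 : b • (⟨w, hw⟩ : I) ∈ Ideal.ofList rs • (⊤ : Submodule R I) := by
    refine mem_smul_top_of_exact hs (LinearMap.exact_map_mkQ_range s)
      (Submodule.mkQ_surjective _) hregJ ?_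
    have e : s (b • ⟨w, hw⟩) = s ⟨w, hw⟩ • b := by
      rw [map_smul, smul_eq_mul, smul_eq_mul, mul_comm]
    rwa [e]
  have := Submodule.mem_map_of_mem (f := I.subtype) h1
  rw [Submodule.map_smul''] at this
  have e : w • b = I.subtype (b • ⟨w, hw⟩) := mul_comm w b
  rw [e]
  exact Submodule.smul_mono le_rfl le_top this

variable [IsLocalRing R] [IsNoetherianRing R]

theorem ringKrullDim_quotient_eq_of_isWeaklyRegular [IsLocalRing (R ⧸ J)] (hn : 0 < n)
    (hdim : ringKrullDim R = n) {y : R} (hy : y ∈ R⁰) (hyJ : y ∈ J) {rs : List R}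
    (hlen : rs.length = n - 1) (hmem : ∀ r ∈ rs, r ∈ maximalIdeal R)
    (hreg : IsWeaklyRegular (R ⧸ J) rs) : ringKrullDim (R ⧸ J) = (n - 1 : ℕ) := by
  have hle := ringKrullDim_succ_le_of_surjective (Ideal.Quotient.mk J)
    Ideal.Quotient.mk_surjective hy (Ideal.Quotient.eq_zero_iff_mem.mpr hyJ)
  have hmem' : ∀ r ∈ rs.map (Ideal.Quotient.mk J), r ∈ maximalIdeal (R ⧸ J) := by
    simpa only [List.forall_mem_map, mk_mem_maximalIdeal_iff] using hmem
  have heq := ringKrullDim_add_length_eq_ringKrullDim_of_isRegular (rs.map (Ideal.Quotient.mk J))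
    ((isRegular_iff_isWeaklyRegular_of_subset_maximalIdeal hmem').mpr
      ((isWeaklyRegular_map_algebraMap_iff (R ⧸ J) _ rs).mpr hreg))
  have hloc := isLocalRing_quotient_ofList hmem'
  have h0 : 0 ≤ ringKrullDim ((R ⧸ J) ⧸ Ideal.ofList (rs.map (Ideal.Quotient.mk J))) :=
    ringKrullDim_nonneg_of_nontrivial
  rw [List.length_map, hlen] at heq
  have hn' : ((n - 1 : ℕ) : WithBot ℕ∞) + 1 = n := by exact_mod_cast Nat.sub_add_cancel hn
  refine le_antisymm ?_ (heq ▸ le_add_of_nonneg_left h0)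
  rw [hdim, ← hn'] at hle
  exact ENat.WithBot.add_le_add_one_right_iff.mp hle

/-- If multiplication by `w` embeds `R / 𝔟` into `R / 𝔞`, where `R / 𝔞` has simple socle and
`𝔪` is nilpotent modulo the proper ideal `𝔟`, then `R / 𝔟` has simple socle. -/
theorem hasSimpleSocle_quotient_of_mul_mem_iff {𝔞 𝔟 : Ideal R} (hsoc : HasSimpleSocle R (R ⧸ 𝔞))
    {w : R} (hw : ∀ r, r * w ∈ 𝔞 ↔ r ∈ 𝔟) (htop : 𝔟 ≠ ⊤)
    (hnil : ∀ x ∈ maximalIdeal R, ∃ N : ℕ, x ^ N ∈ 𝔟) : HasSimpleSocle R (R ⧸ 𝔟) := by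
  obtain ⟨u, hu0, hu, hspan⟩ := hsoc
  have hrad : maximalIdeal R ≤ 𝔟.radical := fun x hx ↦ hnil x hx
  have hex : ∃ k : ℕ, maximalIdeal R ^ k ≤ 𝔟 :=
    Ideal.exists_pow_le_of_le_radical_of_fg hrad (IsNoetherian.noetherian _)
  classical
  obtain ⟨k, hk⟩ : ∃ k, Nat.find hex = k + 1 := Nat.exists_eq_succ_of_ne_zero fun h ↦ by
    have := Nat.find_spec hex
    rw [h, pow_zero, Ideal.one_eq_top, top_le_iff] at this
    exact htop this
  obtain ⟨z, hz, hz'⟩ := SetLike.not_le_iff_exists.mp (Nat.find_min hex (m := k) (by omega))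
  have hz'' (r : R) (hr : r ∈ maximalIdeal R) : r * z ∈ 𝔟 := by
    have h1 : maximalIdeal R ^ (k + 1) ≤ 𝔟 := hk ▸ Nat.find_spec hex
    exact h1 (pow_succ' (maximalIdeal R) k ▸ Ideal.mul_mem_mul hr hz)
  have key (v : R) (hv : ∀ r ∈ maximalIdeal R, r * v ∈ 𝔟) :
      ∃ a : R, Ideal.Quotient.mk 𝔞 (v * w) = a • u :=
    hspan _ fun r hr ↦ Ideal.Quotient.eq_zero_iff_mem.mpr
      (by simpa [mul_assoc] using (hw _).mpr (hv r hr))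
  obtain ⟨a₀, ha₀⟩ := key z hz''
  have hunit : IsUnit a₀ := by
    by_contra h
    rw [hu a₀ h, Ideal.Quotient.eq_zero_iff_mem, hw] at ha₀
    exact hz' ha₀
  obtain ⟨b, hb⟩ := hunit.exists_left_inv
  refine ⟨Ideal.Quotient.mk 𝔟 z, fun h ↦ hz' (Ideal.Quotient.eq_zero_iff_mem.mp h),
    fun r hr ↦ Ideal.Quotient.eq_zero_iff_mem.mpr (hz'' r hr), fun v hv ↦ ?_⟩
  obtain ⟨v, rfl⟩ := Ideal.Quotient.mk_surjective v
  obtain ⟨a, ha⟩ := key v fun r hr ↦ Ideal.Quotient.eq_zero_iff_mem.mp (hv r hr)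
  refine ⟨a * b, Ideal.Quotient.eq.mpr ((hw _).mp (Ideal.Quotient.eq_zero_iff_mem.mp ?_))⟩
  have e : (v - a * b * z) * w = v * w - (a * b) * (z * w) := by ring
  have h2 : Ideal.Quotient.mk 𝔞 ((a * b) * (z * w)) =
    (a * b) • Ideal.Quotient.mk 𝔞 (z * w) := rfl
  change Ideal.Quotient.mk 𝔞 ((v - a * b * z) * w) = 0
  rw [e, map_sub, h2, ha₀, ha, smul_smul, mul_assoc, hb, mul_one, sub_self]

variable [IsLocalRing (R ⧸ I)]

theorem isGorensteinLocalOfDim_quotient_range (hn : 0 < n) (hI : I ≠ ⊤)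
    (hGR : IsGorensteinLocalOfDim R n) (hGRI : IsGorensteinLocalOfDim (R ⧸ I) (n - 1))
    {s : I →ₗ[R] R} (hs : Function.Injective s)
    (hgen : ∀ f : I →ₗ[R] R, ∃ p q : R, f = p • I.subtype + q • s)
    (hJ : (LinearMap.range s : Ideal R) ≠ ⊤) [IsLocalRing (R ⧸ (LinearMap.range s : Ideal R))] :
    IsGorensteinLocalOfDim (R ⧸ (LinearMap.range s : Ideal R)) (n - 1) := by
  set J : Ideal R := LinearMap.range s with hJdef
  obtain ⟨rs, hlen, hmem, hreg, hregI, hregJ⟩ := exists_isWeaklyRegular_self_and_pair (R := R)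
    (R ⧸ I) (R ⧸ J) (n - 1) 1 one_ne_zero (fun i hi ↦ hGR.subsingleton_ext (by omega))
    (fun i hi ↦ hGRI.subsingleton_ext_quotient hi)
    (fun i hi ↦ subsingleton_ext_quotient_range hGR hGRI hs hi)
  rw [pow_one] at hmem
  obtain ⟨w, hw, hregw⟩ := exists_mem_isWeaklyRegular_append hn hGR hGRI hlen hmem hreg hregI
  have hmemw := mem_maximalIdeal_of_mem_append hI hmem hw
  have hregy := isWeaklyRegular_append_apply hregw hw hs hregJ
  have hyJ : s ⟨w, hw⟩ ∈ J := ⟨_, rfl⟩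
  have hmemy := mem_maximalIdeal_of_mem_append hJ hmem hyJ
  have hleny : (rs ++ [s ⟨w, hw⟩]).length = n := by simp; omega
  have hy : s ⟨w, hw⟩ ∈ R⁰ := by
    have h1 := isWeaklyRegular_of_perm_of_subset_maximalIdeal hregy List.perm_append_comm hmemy
    rw [List.singleton_append, isWeaklyRegular_cons_iff] at h1
    exact mem_nonZeroDivisors_iff.mpr
      ⟨fun x hx ↦ h1.1.right_eq_zero_of_smul hx,
        fun x hx ↦ h1.1.right_eq_zero_of_smul (by rwa [smul_eq_mul, mul_comm])⟩
  have hdim := ringKrullDim_quotient_eq_of_isWeaklyRegular hn hGR.2.1 hy hyJ hlen hmem hregJ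
  have hwreg : ∀ x : R, w * x ∈ Ideal.ofList rs → x ∈ Ideal.ofList rs := by
    simpa only [smul_eq_mul, Ideal.mul_top] using
      (isWeaklyRegular_append_singleton_iff.mp hregw).2
  have happ : Ideal.ofList (rs ++ [s ⟨w, hw⟩]) =
      Ideal.ofList rs ⊔ Ideal.span {s ⟨w, hw⟩} := by
    rw [Ideal.ofList_append, Ideal.ofList_singleton]
  have hle : Ideal.ofList (rs ++ [s ⟨w, hw⟩]) ≤ J ⊔ Ideal.ofList rs := by
    rw [happ]
    exact sup_le le_sup_right (((Ideal.span_singleton_le_iff_mem _).mpr hyJ).trans le_sup_left)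
  have hiff (r : R) : r * w ∈ Ideal.ofList (rs ++ [s ⟨w, hw⟩]) ↔ r ∈ J ⊔ Ideal.ofList rs := by
    rw [happ]
    constructor
    · intro h
      obtain ⟨q, hq, v, hv, hqv⟩ := Submodule.mem_sup.mp h
      obtain ⟨c, rfl⟩ := Ideal.mem_span_singleton.mp hv
      refine mem_range_sup_ofList_of_mul_sub_mem hGR (by simp; omega) hmemw hregw hregI hw hgen
        (c := c) fun a ↦ hwreg _ ?_
      have e : w * (r * a - c * s a) = a * q := by
        have := mul_apply_comm s ⟨w, hw⟩ a
        simp only at this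
        linear_combination -c * this - a * hqv
      rw [e]
      exact Ideal.mul_mem_left _ _ hq
    · intro h
      obtain ⟨_, ⟨i, rfl⟩, q, hq, rfl⟩ := Submodule.mem_sup.mp h
      have e : (s i + q) * w = w * q + i * s ⟨w, hw⟩ := by
        have := mul_apply_comm s ⟨w, hw⟩ i
        simp only at this
        linear_combination this
      rw [e]
      exact Submodule.add_mem_sup (Ideal.mul_mem_left _ _ hq)
        (Ideal.mul_mem_left _ _ (Ideal.mem_span_singleton_self _))
  have hsoc : HasSimpleSocle R (R ⧸ (J ⊔ Ideal.ofList rs)) :=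
    hasSimpleSocle_quotient_of_mul_mem_iff
      (hGR.hasSimpleSocle_quotient_ofList hleny hmemy hregy) hiff
      (ne_top_of_le_ne_top (Ideal.IsPrime.ne_top' (I := maximalIdeal R))
        (sup_le (le_maximalIdeal hJ) (ofList_le_maximalIdeal hmem)))
      fun x hx ↦ by
        obtain ⟨N, hN⟩ := exists_pow_mem_ofList (hleny ▸ hGR.2.1) hmemy hregy hx
        exact ⟨N, hle hN⟩
  have hmem' : ∀ r ∈ rs.map (Ideal.Quotient.mk J), r ∈ maximalIdeal (R ⧸ J) := by
    simpa only [List.forall_mem_map, mk_mem_maximalIdeal_iff] using hmem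
  refine isGorensteinLocalOfDim_of_isWeaklyRegular hdim hmem'
    ((isWeaklyRegular_map_algebraMap_iff (R ⧸ J) _ rs).mpr hregJ) (by simpa using hlen) ?_
  rw [hasSimpleSocle_quotient_iff]
  refine hsoc.congr ((Submodule.quotEquivOfEq _ _ ?_).trans
    (LinearMap.quotKerEquivOfSurjective
      ((Submodule.mkQ (Ideal.ofList (rs.map (Ideal.Quotient.mk J)) •
        (⊤ : Submodule (R ⧸ J) (R ⧸ J)))).restrictScalars R ∘ₗ Submodule.mkQ J)
      ((Submodule.mkQ_surjective _).comp (Submodule.mkQ_surjective J))))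
  ext x
  have h1 : x ∈ J ⊔ Ideal.ofList rs ↔
      Ideal.Quotient.mk J x ∈ Ideal.ofList (rs.map (Ideal.Quotient.mk J)) := by
    rw [← Ideal.map_ofList, ← Ideal.mem_comap,
      Ideal.comap_map_of_surjective' _ Ideal.Quotient.mk_surjective, Ideal.mk_ker, sup_comm]
  rw [h1, LinearMap.mem_ker]
  refine Iff.trans ?_ (Submodule.Quotient.mk_eq_zero _).symm
  rw [smul_eq_mul, Ideal.mul_top]
  rfl

end Conclusion

end Auxiliary

/-- In the unprojection setup, let `s : I → R` be injective with class
generating `Ext¹_R(R/I, R) ≅ Hom_R(I,R)/(R·ι)` as an `R/I`-module, `J = s(I)`, with `I` not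
principal (so `J ≠ R`).  Then `Ext¹_R(R/J, R) ≅ Hom_R(J, R)/(R·ι_J)` is a free `R/J`-module
of rank one generated by the class of `t = s⁻¹ : J → R` (i.e. the annihilator of the class
of `t` is exactly `J` and its class spans).  Consequently `R/J` is a Gorenstein local ring
of Krull dimension `n - 1`. -/
theorem numerator_quotient_isGorenstein (R : Type) [CommRing R] [IsLocalRing R] (n : ℕ)
    (hn : 0 < n) (I : Ideal R) (hI : I ≠ ⊤) [IsLocalRing (R ⧸ I)]
    (hGR : IsGorensteinLocalOfDim R n)
    (hGRI : IsGorensteinLocalOfDim (R ⧸ I) (n - 1))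
    (s : I →ₗ[R] R) (hs : Function.Injective s)
    (hgen : Submodule.span R
      {(Submodule.Quotient.mk s :
          (I →ₗ[R] R) ⧸ Submodule.span R {Submodule.subtype I})} = ⊤)
    (hnp : ¬ I.IsPrincipal) :
    (∀ r : R,
      r • (Submodule.Quotient.mk (inverseHom R I s hs) :
          ((LinearMap.range s : Ideal R) →ₗ[R] R) ⧸
            Submodule.span R {Submodule.subtype (LinearMap.range s : Ideal R)}) = 0 ↔
        r ∈ (LinearMap.range s : Ideal R)) ∧
    Submodule.span R
      {(Submodule.Quotient.mk (inverseHom R I s hs) :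
          ((LinearMap.range s : Ideal R) →ₗ[R] R) ⧸
            Submodule.span R {Submodule.subtype (LinearMap.range s : Ideal R)})} = ⊤ ∧
    ∃ h : IsLocalRing (R ⧸ (LinearMap.range s : Ideal R)),
      @IsGorensteinLocalOfDim (R ⧸ (LinearMap.range s : Ideal R)) _ h (n - 1) := by
  have : IsNoetherianRing R := hGR.1
  have hgen' := exists_smul_add_smul_of_span_eq_top hgen
  have hJ : (LinearMap.range s : Ideal R) ≠ ⊤ := fun h ↦ hnp (isPrincipal_of_range_eq_top hs h)
  have : Nontrivial (R ⧸ (LinearMap.range s : Ideal R)) := Ideal.Quotient.nontrivial_iff.mpr hJ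
  have hloc : IsLocalRing (R ⧸ (LinearMap.range s : Ideal R)) :=
    .of_surjective' (Ideal.Quotient.mk _) Ideal.Quotient.mk_surjective
  exact ⟨fun r ↦ (smul_mk_inverseHom_eq_zero_iff hs r).trans
      (mem_range_iff_exists_mul_eq hn hI hGR hGRI hgen' r),
    span_mk_inverseHom_eq_top hs hgen', hloc,
    isGorensteinLocalOfDim_quotient_range hn hI hGR hGRI hs hgen' hJ⟩
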